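/- arXiv:2203.08793 — 2 statements merged into one kernel-verified Lean document; each statement's English description precedes it below -/
import Mathlib

section
/- Let G = ⟨A, x | x² = y, xax⁻¹ = f(a)⟩ with A finite abelian of order ≥ 3, f ∈ Aut(A) of order 2, f(y) = y, B = {f(a)a⁻¹ : a ∈ A}. Then G has exactly (|A| − [A:B])/2 inequivalent irreducible 2-dimensional representations, and every irreducible representation of G has dimension 1 or 2; in particular G has exactly 2[A:B] + (|A| − [A:B])/2 irreducible representations up to equivalence. -/
open CategoryTheory

structure S7 {G : Type} [Group G] (A : Subgroup G) (f : ↥A ≃* ↥A) (x : G) (y : ↥A) : Prop where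
  hA : ∀ a b : ↥A, a * b = b * a
  hidx : A.index = 2
  hf2 : ∀ a : ↥A, f (f a) = a
  hx : x ∉ A
  hy : f y = y
  hx2 : x ^ 2 = (y : G)
  hconj : ∀ a : ↥A, x * (a : G) * x⁻¹ = ((f a : ↥A) : G)

namespace S7
variable {G : Type} [Group G] {A : Subgroup G} {f : ↥A ≃* ↥A} {x : G} {y : ↥A}

lemma conj' (S : S7 A f x y) (a : A) : x * (a : G) = (f a : G) * x := by
  rw [← S.hconj a]; group

lemma out (S : S7 A f x y) {g : G} (hg : g ∉ A) : ∃ a : A, g = a * x := by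
  have hxi : x⁻¹ ∉ A := by simpa using S.hx
  have := (Subgroup.mul_mem_iff_of_index_two S.hidx (a := g) (b := x⁻¹))
  exact ⟨⟨g * x⁻¹, by rw [this]; tauto⟩, by simp⟩

lemma mulx_notin (S : S7 A f x y) (a : A) : (a : G) * x ∉ A := by
  intro h
  exact S.hx ((Subgroup.mul_mem_cancel_left A a.2).1 h)

lemma exists_ind (S : S7 A f x y) (χ : A →* ℂˣ) :
    ∃ ρ : Representation ℂ G (ℂ × ℂ),
      (∀ (a : A) p, ρ a p = ((χ a : ℂ) * p.1, (χ (f a) : ℂ) * p.2)) ∧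
      ∀ p, ρ x p = ((χ y : ℂ) * p.2, p.1) := by
  classical
  let D : A → ℂ × ℂ →ₗ[ℂ] ℂ × ℂ := fun a =>
    ((χ a : ℂ) • LinearMap.fst ℂ ℂ ℂ).prod ((χ (f a) : ℂ) • LinearMap.snd ℂ ℂ ℂ)
  let X : ℂ × ℂ →ₗ[ℂ] ℂ × ℂ :=
    ((χ y : ℂ) • LinearMap.snd ℂ ℂ ℂ).prod (LinearMap.fst ℂ ℂ ℂ)
  have hDD : ∀ a b, D (a * b) = D a * D b := by
    intro a b; ext <;> simp [D]
  have hXX : X * X = D y := by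
    ext <;> simp [D, X, S.hy]
  have hXD : ∀ a, X * D a = D (f a) * X := by
    intro a; ext <;> simp [D, X, S.hf2, mul_comm]
  have hD1 : D 1 = 1 := by ext <;> simp [D]
  have hmem : ∀ g : G, g ∉ A → g * x⁻¹ ∈ A := by
    intro g hg
    obtain ⟨a, rfl⟩ := S.out hg
    simp
  let F : G → ℂ × ℂ →ₗ[ℂ] ℂ × ℂ := fun g =>
    if h : g ∈ A then D ⟨g, h⟩ else D ⟨g * x⁻¹, hmem g h⟩ * X
  have hF1 : ∀ a : A, F a = D a := by intro a; simp [F]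
  have hF2 : ∀ a : A, F (a * x) = D a * X := by
    intro a
    simp only [F, dif_neg (S.mulx_notin a)]
    congr 2
    ext; simp
  have hmul : ∀ g h, F (g * h) = F g * F h := by
    intro g h
    by_cases hg : g ∈ A <;> by_cases hh : h ∈ A
    · lift g to A using hg
      lift h to A using hh
      rw [← Subgroup.coe_mul, hF1, hF1, hF1, hDD]
    · lift g to A using hg
      obtain ⟨b, rfl⟩ := S.out hh
      rw [← mul_assoc, ← Subgroup.coe_mul, hF2, hF1, hF2, hDD, mul_assoc]
    · lift h to A using hh
      obtain ⟨b, rfl⟩ := S.out hg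
      rw [mul_assoc, S.conj', ← mul_assoc, ← Subgroup.coe_mul, hF2, hF1, hF2, hDD, mul_assoc,
        mul_assoc, hXD]
    · obtain ⟨a, rfl⟩ := S.out hg
      obtain ⟨b, rfl⟩ := S.out hh
      have : (a : G) * x * (b * x) = ((a * f b * y : A) : G) := by
        rw [mul_assoc, ← mul_assoc x, S.conj', Subgroup.coe_mul, Subgroup.coe_mul, ← S.hx2, pow_two]
        simp only [mul_assoc]
      rw [this, hF1, hF2, hF2, hDD, hDD, ← hXX]
      rw [show D a * X * (D b * X) = D a * (X * D b) * X by simp only [mul_assoc], hXD]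
      simp only [mul_assoc]
  refine ⟨⟨⟨F, ?_⟩, hmul⟩, ?_, ?_⟩
  · have := hF1 1
    simpa [hD1] using this
  · intro a p
    show F a p = _
    rw [hF1]; simp [D]
  · intro p
    show F x p = _
    have := hF2 1
    simp only [hD1, Subgroup.coe_one, one_mul] at this
    rw [this]; simp [X]

/-- make a hom -/
def mkHom {V W : FDRep ℂ G} (T : V →ₗ[ℂ] W) (h : ∀ g v, T (V.ρ g v) = W.ρ g (T v)) : V ⟶ W :=
  ⟨InducedCategory.homMk (ModuleCat.ofHom T), fun g ↦ by
    ext v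
    exact h g v⟩

/-- the linear map of a hom -/
def toLin {V W : FDRep ℂ G} (T : V ⟶ W) : V →ₗ[ℂ] W := T.hom.hom.hom

lemma toLin_comm {V W : FDRep ℂ G} (T : V ⟶ W) (g v) : toLin T (V.ρ g v) = W.ρ g (toLin T v) :=
  ConcreteCategory.congr_hom ((forget (FGModuleCat ℂ)).congr_map (T.comm g)) v

lemma toLin_mk {V W : FDRep ℂ G} (T : V →ₗ[ℂ] W) (h) : toLin (mkHom T h) = T := rfl

lemma toLin_inj {V W : FDRep ℂ G} {T U : V ⟶ W} (h : toLin T = toLin U) : T = U := by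
  ext v
  exact congrArg (fun L => L v) h

lemma iso_of_ne {V W : FDRep ℂ G} [Simple V] [Simple W] (T : V →ₗ[ℂ] W)
    (h : ∀ g v, T (V.ρ g v) = W.ρ g (T v)) (hT : T ≠ 0) : Nonempty (V ≅ W) := by
  have h0 : mkHom T h ≠ 0 := by
    intro h'
    apply hT
    rw [← toLin_mk T h, h']; rfl
  have := isIso_of_hom_simple h0
  exact ⟨asIso (mkHom T h)⟩

lemma finrank_iso {V W : FDRep ℂ G} (e : V ≅ W) : Module.finrank ℂ V = Module.finrank ℂ W :=
  (FDRep.isoToLinearEquiv e).finrank_eq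

lemma simple_of [Finite G] (V : FDRep ℂ G) (v : V) (hv : v ≠ 0)
    (h : ∀ T : V →ₗ[ℂ] V, (∀ g v, T (V.ρ g v) = V.ρ g (T v)) → ∃ c : ℂ, T = c • LinearMap.id) :
    Simple V := by
  have : NeZero (Nat.card G : ℂ) := ⟨Nat.cast_ne_zero.2 Nat.card_pos.ne'⟩
  rw [FDRep.simple_iff_end_is_rank_one]
  rw [finrank_eq_one_iff']
  refine ⟨𝟙 V, ?_, ?_⟩
  · intro h0
    apply hv
    exact congrArg (fun L => toLin L v) h0
  · intro T
    obtain ⟨c, hc⟩ := h (toLin T) (toLin_comm T)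
    exact ⟨c, toLin_inj hc.symm⟩

lemma exists_lin [Finite G] (ψ : G →* ℂˣ) : ∃ V : FDRep ℂ G, Simple V ∧ Module.finrank ℂ V = 1 ∧
    (∀ g v, V.ρ g v = (ψ g : ℂ) • v) ∧
    ∀ W : FDRep ℂ G, Simple W → ∀ w : W, w ≠ 0 → (∀ g, W.ρ g w = (ψ g : ℂ) • w) →
      Nonempty (V ≅ W) := by
  let ρ : Representation ℂ G ℂ :=
    ⟨⟨fun g => (ψ g : ℂ) • LinearMap.id, by ext; simp⟩, by intro g h; ext; simp [mul_comm]⟩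
  have hs : Simple (FDRep.of ρ) := by
    apply simple_of (FDRep.of ρ) (1 : ℂ) one_ne_zero
    intro (T : ℂ →ₗ[ℂ] ℂ) hT
    refine ⟨T 1, ?_⟩
    show T = T 1 • LinearMap.id
    ext; simp
  refine ⟨FDRep.of ρ, hs, ?_, ?_, ?_⟩
  · exact Module.finrank_self ℂ
  · intro g v; rfl
  · intro W hW w hw h
    apply iso_of_ne (V := FDRep.of ρ) (W := W) (LinearMap.toSpanSingleton ℂ W w)
    · intro g (v : ℂ)
      show ((ψ g : ℂ) * v) • w = W.ρ g (v • w)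
      rw [map_smul, h, smul_smul, mul_comm]
    · intro h0
      apply hw
      have := congrArg (fun L => L (1:ℂ)) h0
      simpa using this

/-- `χ` occurs in the restriction of `V` to `A`. -/
def Eig (A : Subgroup G) (V : FDRep ℂ G) (χ : A →* ℂˣ) : Prop :=
  ∃ v : V, v ≠ 0 ∧ ∀ a : A, V.ρ a v = (χ a : ℂ) • v

lemma Eig.iso {V W : FDRep ℂ G} {χ : A →* ℂˣ} (h : Eig A V χ) (e : V ≅ W) : Eig A W χ := by
  obtain ⟨v, hv, h⟩ := h
  have hinv : ∀ u : V, toLin e.inv (toLin e.hom u) = u := by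
    intro u
    exact congrArg (fun L => toLin L u) e.hom_inv_id
  refine ⟨toLin e.hom v, ?_, ?_⟩
  · intro h0
    apply hv
    rw [← hinv v, h0, map_zero]
  · intro a
    rw [← toLin_comm, h, map_smul]

lemma exists_ne_zero (V : FDRep ℂ G) [Simple V] : ∃ v : V, v ≠ 0 := by
  by_contra! h
  apply id_nonzero V
  apply toLin_inj
  ext v
  rw [h v, map_zero, map_zero]

lemma exists_eig [Finite G] (S : S7 A f x y) (V : FDRep ℂ G) (v : V) (hv : v ≠ 0) :
    ∃ χ : A →* ℂˣ, Eig A V χ := by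
  classical
  let : CommGroup A := { (inferInstance : Group A) with mul_comm := S.hA }
  have : Fintype A := Fintype.ofFinite A
  have : Finite (A →* ℂˣ) := by
    have := CommGroup.card_monoidHom_of_hasEnoughRootsOfUnity A ℂ
    exact Nat.finite_of_card_ne_zero (by rw [this]; exact Nat.card_pos.ne')
  have : Fintype (A →* ℂˣ) := Fintype.ofFinite _
  let P : (A →* ℂˣ) → V := fun χ => ∑ a : A, (χ a⁻¹ : ℂ) • V.ρ a v
  have hP : ∀ χ (b : A), V.ρ b (P χ) = (χ b : ℂ) • P χ := by
    intro χ b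
    simp only [P, map_sum, Finset.smul_sum, map_smul]
    refine Fintype.sum_equiv (Equiv.mulLeft b) _ _ ?_
    intro a
    simp only [Equiv.coe_mulLeft, mul_inv, map_mul, Subgroup.coe_mul, smul_smul, Units.val_mul,
      Module.End.mul_apply]
    congr 1
    rw [← mul_assoc, ← Units.val_mul, ← map_mul]
    simp
  by_contra! hno
  have hP0 : ∀ χ, P χ = 0 := by
    intro χ
    by_contra h0
    exact hno χ ⟨P χ, h0, hP χ⟩
  have hsum : ∑ χ, P χ = (Fintype.card (A →* ℂˣ) : ℂ) • v := by
    simp only [P]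
    rw [Finset.sum_comm, Finset.sum_eq_single 1]
    · simp [Nat.cast_smul_eq_nsmul]
    · intro a _ ha
      obtain ⟨φ, hφ⟩ := CommGroup.exists_apply_ne_one_of_hasEnoughRootsOfUnity A ℂ (a := a⁻¹)
        (by simpa using ha)
      rw [← Finset.sum_smul]
      have : ∑ χ : A →* ℂˣ, (χ a⁻¹ : ℂ) = 0 := by
        have h1 : ∑ χ : A →* ℂˣ, (χ a⁻¹ : ℂ) = (φ a⁻¹ : ℂ) * ∑ χ : A →* ℂˣ, (χ a⁻¹ : ℂ) := by
          rw [Finset.mul_sum]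
          refine (Fintype.sum_equiv (Equiv.mulLeft φ) _ _ ?_).symm
          intro χ
          simp
        have h2 : ((φ a⁻¹ : ℂ) - 1) * ∑ χ : A →* ℂˣ, (χ a⁻¹ : ℂ) = 0 := by
          rw [sub_mul, ← h1]; ring
        rcases mul_eq_zero.1 h2 with h | h
        · exfalso
          apply hφ
          ext
          rw [sub_eq_zero.1 h]; rfl
        · exact h
      rw [this, zero_smul]
    · simp
  simp only [hP0, Finset.sum_const_zero] at hsum
  rcases smul_eq_zero.1 hsum.symm with h | h
  · exact Fintype.card_ne_zero (Nat.cast_eq_zero.1 h)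
  · exact hv h

lemma exists_indrep [Finite G] (S : S7 A f x y) (χ : A →* ℂˣ)
    (hχ : χ.comp f.toMonoidHom ≠ χ) :
    ∃ V : FDRep ℂ G, Simple V ∧ Module.finrank ℂ V = 2 ∧
      (∀ W : FDRep ℂ G, Simple W → Eig A W χ → Nonempty (V ≅ W)) ∧
      (∀ χ', Eig A V χ' ↔ (χ' = χ ∨ χ' = χ.comp f.toMonoidHom)) := by
  obtain ⟨ρ, h1, h2⟩ := S.exists_ind χ
  obtain ⟨a, ha⟩ : ∃ a, χ (f a) ≠ χ a := by
    by_contra! h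
    exact hχ (MonoidHom.ext h)
  have ha' : (χ (f a) : ℂ) ≠ χ a := fun h => ha (Units.ext h)
  have hs : Simple (FDRep.of ρ) := by
    apply simple_of (FDRep.of ρ) ((1, 0) : ℂ × ℂ) (by simp)
    intro (T : ℂ × ℂ →ₗ[ℂ] ℂ × ℂ) (hT : ∀ (g : G) (v : ℂ × ℂ), T (ρ g v) = ρ g (T v))
    have e1 := hT a (1, 0)
    have e2 : (T (1, 0)).2 = 0 := by
      rw [h1, h1] at e1
      have : (((χ a : ℂ) * 1, (χ (f a) : ℂ) * 0) : ℂ × ℂ) = (χ a : ℂ) • (1, 0) := by simp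
      simp only [this, map_smul] at e1
      have := congrArg Prod.snd e1
      simp only [Prod.smul_snd, smul_eq_mul] at this
      have h3 : ((χ a : ℂ) - χ (f a)) * (T (1, 0)).2 = 0 := by rw [sub_mul, this]; ring
      rcases mul_eq_zero.1 h3 with h | h
      · exact absurd (sub_eq_zero.1 h).symm ha'
      · exact h
    have e3 : T (0, 1) = (0, (T (1, 0)).1) := by
      have := hT x (1, 0)
      rw [h2, h2] at this
      simpa [e2] using this
    refine ⟨(T (1, 0)).1, ?_⟩
    show T = (T (1, 0)).1 • LinearMap.id
    ext
    · simp
    · simp [e2]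
    · simp [e3]
    · simp [e3]
  refine ⟨FDRep.of ρ, hs, ?_, ?_, ?_⟩
  · show Module.finrank ℂ (ℂ × ℂ) = 2
    simp
  · rintro W hW ⟨w, hw, h⟩
    have hxx : W.ρ x (W.ρ x w) = (χ y : ℂ) • w := by
      rw [← Module.End.mul_apply, ← map_mul, ← pow_two, S.hx2, h]
    have hax : ∀ a : A, W.ρ a (W.ρ x w) = (χ (f a) : ℂ) • W.ρ x w := by
      intro a
      have := S.conj' (f a)
      rw [S.hf2] at this
      rw [← Module.End.mul_apply, ← map_mul, ← this, map_mul, Module.End.mul_apply, h, map_smul]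
    let T : ℂ × ℂ →ₗ[ℂ] W := (LinearMap.toSpanSingleton ℂ W w).coprod
      (LinearMap.toSpanSingleton ℂ W (W.ρ x w))
    have hT : ∀ p, T p = p.1 • w + p.2 • W.ρ x w := by intro p; simp [T]
    have hTa : ∀ (a : A) p, T (ρ a p) = W.ρ a (T p) := by
      intro a p
      rw [hT, hT, h1, map_add, map_smul, map_smul, h, hax, smul_smul, smul_smul, mul_comm,
        mul_comm p.2]
    have hTx : ∀ p, T (ρ x p) = W.ρ x (T p) := by
      intro p
      rw [hT, hT, h2, map_add, map_smul, map_smul, hxx, smul_smul, add_comm, mul_comm p.2]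
    apply iso_of_ne (V := FDRep.of ρ) (W := W) T
    · intro g (p : ℂ × ℂ)
      show T (ρ g p) = W.ρ g (T p)
      by_cases hg : g ∈ A
      · exact hTa ⟨g, hg⟩ p
      · obtain ⟨b, rfl⟩ := S.out hg
        rw [map_mul, map_mul, Module.End.mul_apply, Module.End.mul_apply, hTa, hTx]
    · intro h0
      apply hw
      have := hT (1, 0)
      rw [h0] at this
      simpa using this.symm
  · intro χ'
    constructor
    · rintro ⟨(v : ℂ × ℂ), hv, h⟩
      have h : ∀ a : A, ρ a v = (χ' a : ℂ) • v := h
      have hv : v ≠ 0 := hv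
      by_cases hv1 : v.1 = 0
      · have hv2 : v.2 ≠ 0 := fun h' => hv (Prod.ext hv1 h')
        right
        ext a
        have := congrArg Prod.snd (h a)
        rw [h1] at this
        exact (mul_right_cancel₀ hv2 this).symm
      · left
        ext a
        have := congrArg Prod.fst (h a)
        rw [h1] at this
        exact (mul_right_cancel₀ hv1 this).symm
    · rintro (rfl | rfl)
      · refine ⟨((1, 0) : ℂ × ℂ), by simp, ?_⟩
        intro a
        show ρ a (1, 0) = (χ' a : ℂ) • ((1, 0) : ℂ × ℂ)
        rw [h1]; simp
      · refine ⟨((0, 1) : ℂ × ℂ), by simp, ?_⟩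
        intro a
        show ρ a (0, 1) = (χ (f a) : ℂ) • ((0, 1) : ℂ × ℂ)
        rw [h1]; simp

lemma exists_char (S : S7 A f x y) (V : FDRep ℂ G) (χ : A →* ℂˣ)
    (hχ : χ.comp f.toMonoidHom = χ) (hV : Eig A V χ) :
    ∃ (ψ : G →* ℂˣ) (w : V), w ≠ 0 ∧ ∀ g, V.ρ g w = (ψ g : ℂ) • w := by
  obtain ⟨v, hv, h⟩ := hV
  have hf : ∀ a, χ (f a) = χ a := fun a => DFunLike.congr_fun hχ a
  have hxx : V.ρ x (V.ρ x v) = (χ y : ℂ) • v := by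
    rw [← Module.End.mul_apply, ← map_mul, ← pow_two, S.hx2, h]
  have hax : ∀ a : A, V.ρ a (V.ρ x v) = (χ a : ℂ) • V.ρ x v := by
    intro a
    have := S.conj' (f a)
    rw [S.hf2] at this
    rw [← Module.End.mul_apply, ← map_mul, ← this, map_mul, Module.End.mul_apply, h, map_smul, hf]
  obtain ⟨c, hc⟩ := IsAlgClosed.exists_pow_nat_eq (χ y : ℂ) (n := 2) (by norm_num)
  obtain ⟨w, hw, hwa, d, hwx⟩ : ∃ w : V, w ≠ 0 ∧ (∀ a : A, V.ρ a w = (χ a : ℂ) • w) ∧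
      ∃ d : ℂ, V.ρ x w = d • w := by
    by_cases h0 : V.ρ x v + c • v = 0
    · refine ⟨v, hv, h, -c, ?_⟩
      rw [neg_smul]
      exact eq_neg_of_add_eq_zero_left h0
    · refine ⟨_, h0, ?_, c, ?_⟩
      · intro a
        rw [map_add, map_smul, hax, h, smul_add, smul_comm]
      · rw [map_add, map_smul, hxx, smul_add, smul_smul, ← hc, pow_two, add_comm]
  have hall : ∀ g, ∃ d : ℂ, V.ρ g w = d • w := by
    intro g
    by_cases hg : g ∈ A
    · exact ⟨_, hwa ⟨g, hg⟩⟩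
    · obtain ⟨b, rfl⟩ := S.out hg
      refine ⟨d * χ b, ?_⟩
      rw [map_mul, Module.End.mul_apply, hwx, map_smul, hwa, smul_smul]
  choose e he using hall
  have hinj : ∀ c d : ℂ, c • w = d • w → c = d := fun c d h => smul_left_injective ℂ hw h
  let ψ : G →* ℂ := ⟨⟨e, hinj _ _ (by rw [← he]; simp)⟩, by
    intro g k
    apply hinj
    show e (g * k) • w = (e g * e k) • w
    rw [← he, map_mul, Module.End.mul_apply, he, map_smul, he, smul_smul, mul_comm]⟩
  exact ⟨ψ.toHomUnits, w, hw, he⟩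

lemma quot_eq {p : FDRep ℂ G → Prop} (V W : {V : FDRep ℂ G // p V}) :
    (Quot.mk (fun V W : {V : FDRep ℂ G // p V} => Nonempty ((V : FDRep ℂ G) ≅ (W : FDRep ℂ G))) V
      = Quot.mk _ W) ↔ Nonempty ((V : FDRep ℂ G) ≅ (W : FDRep ℂ G)) := by
  constructor
  · intro h
    have h' := Quot.eqvGen_exact h
    have heq : Equivalence (fun V W : {V : FDRep ℂ G // p V} =>
        Nonempty ((V : FDRep ℂ G) ≅ (W : FDRep ℂ G))) :=
      ⟨fun V => ⟨Iso.refl _⟩, fun ⟨e⟩ => ⟨e.symm⟩, fun ⟨e⟩ ⟨e'⟩ => ⟨e ≪≫ e'⟩⟩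
    exact heq.eqvGen_iff.1 h'
  · intro h
    exact Quot.sound h

/-- the subgroup `B`. -/
abbrev BB (f : ↥A ≃* ↥A) : Subgroup A := Subgroup.closure {b : ↥A | ∃ a : ↥A, b = f a * a⁻¹}

lemma fixed_iff (χ : A →* ℂˣ) : χ.comp f.toMonoidHom = χ ↔ BB f ≤ χ.ker := by
  rw [Subgroup.closure_le]
  constructor
  · rintro h _ ⟨a, rfl⟩
    have : χ (f a) = χ a := DFunLike.congr_fun h a
    simp [MonoidHom.mem_ker, this]
  · intro h
    ext a
    have : f a * a⁻¹ ∈ χ.ker := h ⟨a, rfl⟩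
    rw [MonoidHom.mem_ker, map_mul, map_inv, mul_inv_eq_one] at this
    exact congrArg Units.val this

lemma finite_char [Finite G] (S : S7 A f x y) : Finite (A →* ℂˣ) := by
  let : CommGroup A := { (inferInstance : Group A) with mul_comm := S.hA }
  have := CommGroup.card_monoidHom_of_hasEnoughRootsOfUnity A ℂ
  exact Nat.finite_of_card_ne_zero (by rw [this]; exact Nat.card_pos.ne')

lemma card_char [Finite G] (S : S7 A f x y) : Nat.card (A →* ℂˣ) = Nat.card A := by
  let : CommGroup A := { (inferInstance : Group A) with mul_comm := S.hA }
  exact CommGroup.card_monoidHom_of_hasEnoughRootsOfUnity A ℂ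

lemma card_fixed [Finite G] (S : S7 A f x y) :
    Nat.card {χ : A →* ℂˣ // χ.comp f.toMonoidHom = χ} = (BB f).index := by
  let : CommGroup A := { (inferInstance : Group A) with mul_comm := S.hA }
  rw [Subgroup.index, ← CommGroup.card_monoidHom_of_hasEnoughRootsOfUnity (A ⧸ BB f) ℂ]
  symm
  refine Nat.card_congr (Equiv.ofBijective
    (fun φ => ⟨φ.comp (QuotientGroup.mk' (BB f)), ?_⟩) ⟨?_, ?_⟩)
  · rw [fixed_iff]
    intro b hb
    have : QuotientGroup.mk' (BB f) b = 1 := (QuotientGroup.eq_one_iff b).2 hb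
    rw [MonoidHom.mem_ker, MonoidHom.comp_apply, this, map_one]
  · intro φ φ' h
    have := congrArg Subtype.val h
    exact (MonoidHom.cancel_right (QuotientGroup.mk'_surjective (BB f))).1 this
  · rintro ⟨χ, hχ⟩
    rw [fixed_iff] at hχ
    refine ⟨QuotientGroup.lift (BB f) χ hχ, ?_⟩
    apply Subtype.ext
    ext a
    rfl

lemma card_nonfixed [Finite G] (S : S7 A f x y) :
    Nat.card {χ : A →* ℂˣ // χ.comp f.toMonoidHom ≠ χ} = Nat.card A - (BB f).index := by
  classical
  have := S.finite_char
  have : Fintype (A →* ℂˣ) := Fintype.ofFinite _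
  rw [← S.card_fixed, ← S.card_char, Nat.card_eq_fintype_card, Nat.card_eq_fintype_card,
    Nat.card_eq_fintype_card]
  exact Fintype.card_subtype_compl _

open scoped commutatorElement in
lemma commutator_eq (S : S7 A f x y) : commutator G = (BB f).map A.subtype := by
  apply le_antisymm
  · have key : ∀ a : A, ((f a * a⁻¹ : A) : G) ∈ (BB f).map A.subtype := fun a =>
      have h : f a * a⁻¹ ∈ BB f := Subgroup.subset_closure ⟨a, rfl⟩
      Subgroup.mem_map_of_mem A.subtype h
    have key2 : ∀ a b : A, ⁅(a : G), (b : G) * x⁆ ∈ (BB f).map A.subtype := by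
      intro a b
      have : ⁅(a : G), (b : G) * x⁆ = ((f a⁻¹ * (a⁻¹)⁻¹ : A) : G) := by
        have h1 := S.hconj a⁻¹
        have h2 : a * b * f a⁻¹ * b⁻¹ = f a⁻¹ * (a⁻¹)⁻¹ := by
          rw [S.hA a b, mul_assoc b, S.hA b, mul_inv_cancel_right, S.hA, inv_inv]
        rw [← h2, commutatorElement_def]
        push_cast at h1 ⊢
        rw [← h1]
        group
      rw [this]; exact key _
    rw [commutator_def, Subgroup.commutator_le]
    intro g _ h _
    by_cases hg : g ∈ A <;> by_cases hh : h ∈ A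
    · have := S.hA ⟨g, hg⟩ ⟨h, hh⟩
      have : g * h = h * g := congrArg Subtype.val this
      rw [commutatorElement_eq_one_iff_mul_comm.2 this]
      exact one_mem _
    · obtain ⟨b, rfl⟩ := S.out hh
      exact key2 ⟨g, hg⟩ b
    · obtain ⟨b, rfl⟩ := S.out hg
      rw [← commutatorElement_inv]
      exact inv_mem (key2 ⟨h, hh⟩ b)
    · obtain ⟨a, rfl⟩ := S.out hg
      obtain ⟨b, rfl⟩ := S.out hh
      have : ⁅(a : G) * x, (b : G) * x⁆ = ((f (b * a⁻¹) * (b * a⁻¹)⁻¹ : A) : G) := by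
        have h1 := S.hconj (b * a⁻¹)
        have h2 : a * f (b * a⁻¹) * b⁻¹ = f (b * a⁻¹) * (b * a⁻¹)⁻¹ := by
          rw [S.hA a, mul_assoc, mul_inv_rev, inv_inv]
        rw [← h2, commutatorElement_def]
        push_cast at h1 ⊢
        rw [← h1]
        group
      rw [this]; exact key _
  · rw [Subgroup.map_le_iff_le_comap, Subgroup.closure_le]
    rintro _ ⟨a, rfl⟩
    have : ((f a * a⁻¹ : A) : G) = ⁅x, (a : G)⁆ := by
      rw [commutatorElement_def, S.hconj]; rfl
    show ((f a * a⁻¹ : A) : G) ∈ commutator G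
    rw [this, commutator_def]
    exact Subgroup.commutator_mem_commutator (Subgroup.mem_top _) (Subgroup.mem_top _)

lemma card_lin [Finite G] (S : S7 A f x y) :
    Nat.card (G →* ℂˣ) = 2 * (BB f).index := by
  have h1 : Nat.card (G →* ℂˣ) = Nat.card (Abelianization G →* ℂˣ) :=
    Nat.card_congr Abelianization.lift
  rw [h1, CommGroup.card_monoidHom_of_hasEnoughRootsOfUnity]
  show (commutator G).index = _
  rw [S.commutator_eq, Subgroup.index_map_subtype, S.hidx, mul_comm]

lemma main [Finite G] (S : S7 A f x y) :
    (∀ V : FDRep ℂ G, Simple V → Module.finrank ℂ V = 1 ∨ Module.finrank ℂ V = 2) ∧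
    Nat.card (Quot (fun (V W : {V : FDRep ℂ G // Simple V ∧ Module.finrank ℂ V = 2}) =>
        Nonempty ((V : FDRep ℂ G) ≅ (W : FDRep ℂ G)))) =
      (Nat.card A - (BB f).index) / 2 ∧
    Nat.card (Quot (fun (V W : {V : FDRep ℂ G // Simple V}) =>
        Nonempty ((V : FDRep ℂ G) ≅ (W : FDRep ℂ G)))) =
      2 * (BB f).index + (Nat.card A - (BB f).index) / 2 := by
  classical
  choose L hLs hL1 hLρ hLi using exists_lin (G := G)
  have hI := fun χ : {χ : A →* ℂˣ // χ.comp f.toMonoidHom ≠ χ} => S.exists_indrep χ.1 χ.2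
  choose I hIs hI2 hIi hIe using hI
  have hclass : ∀ V : FDRep ℂ G, Simple V → (∃ ψ, Nonempty (L ψ ≅ V)) ∨
      ∃ χ, Nonempty (I χ ≅ V) := by
    intro V hV
    obtain ⟨v, hv⟩ := exists_ne_zero V
    obtain ⟨χ, hχ⟩ := S.exists_eig V v hv
    by_cases h : χ.comp f.toMonoidHom = χ
    · obtain ⟨ψ, w, hw, hψ⟩ := S.exists_char V χ h hχ
      exact Or.inl ⟨ψ, hLi ψ V hV w hw hψ⟩
    · exact Or.inr ⟨⟨χ, h⟩, hIi ⟨χ, h⟩ V hV hχ⟩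
  have hclass2 : ∀ V : FDRep ℂ G, Simple V → Module.finrank ℂ V = 2 →
      ∃ χ, Nonempty (I χ ≅ V) := by
    intro V hV h2
    rcases hclass V hV with ⟨ψ, ⟨e⟩⟩ | h
    · have := finrank_iso e
      rw [hL1, h2] at this
      omega
    · exact h
  let Q2 := Quot (fun (V W : {V : FDRep ℂ G // Simple V ∧ Module.finrank ℂ V = 2}) =>
        Nonempty ((V : FDRep ℂ G) ≅ (W : FDRep ℂ G)))
  have hfin := S.finite_char
  let Φ : {χ : A →* ℂˣ // χ.comp f.toMonoidHom ≠ χ} → Q2 := fun χ =>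
    Quot.mk _ ⟨I χ, hIs χ, hI2 χ⟩
  have hΦs : Function.Surjective Φ := by
    rintro ⟨V, hV, h2⟩
    obtain ⟨χ, hχ⟩ := hclass2 V hV h2
    exact ⟨χ, (quot_eq _ _).2 hχ⟩
  have hQfin : Finite Q2 := Finite.of_surjective Φ hΦs
  have hff : ∀ χ : A →* ℂˣ, (χ.comp f.toMonoidHom).comp f.toMonoidHom = χ := by
    intro χ
    ext a
    exact congrArg (fun b => (χ b : ℂ)) (S.hf2 a)
  have hfib : ∀ q : Q2, Nat.card {χ // Φ χ = q} = 2 := by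
    intro q
    obtain ⟨χ, rfl⟩ := hΦs q
    let χ' : {χ : A →* ℂˣ // χ.comp f.toMonoidHom ≠ χ} :=
      ⟨χ.1.comp f.toMonoidHom, by rw [hff]; exact χ.2.symm⟩
    have hne : χ ≠ χ' := fun h => χ.2 (congrArg Subtype.val h).symm
    have hset : {φ | Φ φ = Φ χ} = {χ, χ'} := by
      ext φ
      have h1 : Φ φ = Φ χ ↔ Nonempty (I φ ≅ I χ) := quot_eq _ _
      have h2 : Nonempty (I φ ≅ I χ) ↔ (φ.1 = χ.1 ∨ φ.1 = χ.1.comp f.toMonoidHom) := by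
        rw [← hIe]
        constructor
        · rintro ⟨e⟩
          exact ((hIe φ φ.1).2 (Or.inl rfl)).iso e
        · exact hIi φ (I χ) (hIs χ)
      simp only [Set.mem_ofPred_eq, h1, h2, Set.mem_insert_iff, Set.mem_singleton_iff,
        Subtype.ext_iff, χ']
    have := Set.ncard_pair hne
    rw [← hset] at this
    exact this
  have hcard2 : Nat.card {χ : A →* ℂˣ // χ.comp f.toMonoidHom ≠ χ} = Nat.card Q2 * 2 := by
    have : Fintype Q2 := Fintype.ofFinite _
    rw [← Nat.card_congr (Equiv.sigmaFiberEquiv Φ), Nat.card_sigma]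
    rw [Finset.sum_congr rfl (fun q _ => hfib q)]
    simp
  have hQ2 : Nat.card Q2 = (Nat.card A - (BB f).index) / 2 := by
    rw [← S.card_nonfixed, hcard2]; simp
  refine ⟨?_, hQ2, ?_⟩
  · intro V hV
    rcases hclass V hV with ⟨ψ, ⟨e⟩⟩ | ⟨χ, ⟨e⟩⟩
    · left; rw [← finrank_iso e, hL1]
    · right; rw [← finrank_iso e, hI2]
  · rw [← hQ2, ← S.card_lin]
    have hfinL : Finite (G →* ℂˣ) := Nat.finite_of_card_ne_zero (by
      rw [S.card_lin]
      have : (BB f).index ≠ 0 := Subgroup.index_ne_zero_of_finite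
      omega)
    rw [← Nat.card_sum]
    symm
    refine Nat.card_congr (Equiv.ofBijective (Sum.elim (fun ψ => Quot.mk _ ⟨L ψ, hLs ψ⟩)
      (Quot.map (fun V => ⟨V.1, V.2.1⟩) (fun V W h => h))) ⟨?_, ?_⟩)
    · rintro (ψ | ⟨V, hV, hV2⟩) (ψ' | ⟨W, hW, hW2⟩) h
      · obtain ⟨e⟩ := (quot_eq _ _).1 h
        obtain ⟨v, hv⟩ := @exists_ne_zero G _ (L ψ') (hLs ψ')
        congr 1
        ext g
        have hinv : toLin e.hom (toLin e.inv v) = v :=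
          congrArg (fun T => toLin T v) e.inv_hom_id
        have := toLin_comm e.hom g (toLin e.inv v)
        rw [hLρ, hLρ, map_smul, hinv] at this
        exact smul_left_injective ℂ hv this
      · obtain ⟨e⟩ := (quot_eq _ _).1 h
        exact absurd ((hL1 ψ).symm.trans ((finrank_iso e).trans hW2)) (by norm_num)
      · obtain ⟨e⟩ := (quot_eq _ _).1 h
        exact absurd ((hL1 ψ').symm.trans ((finrank_iso e).symm.trans hV2)) (by norm_num)
      · have := (quot_eq _ _).1 h
        exact congrArg Sum.inr ((quot_eq _ _).2 this)
    · rintro ⟨V, hV⟩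
      rcases hclass V hV with ⟨ψ, h⟩ | ⟨χ, h⟩
      · exact ⟨Sum.inl ψ, (quot_eq _ _).2 h⟩
      · exact ⟨Sum.inr (Φ χ), (quot_eq _ _).2 h⟩

end S7





/-- Every irreducible representation of `G = ⟨A, x | x² = y, xax⁻¹ = f(a)⟩` has
dimension 1 or 2; `G` has exactly `(|A| − [A:B])/2` irreducible 2-dimensional
representations up to equivalence, and exactly `2[A:B] + (|A| − [A:B])/2`
irreducible representations up to equivalence. -/
theorem stmt_7 {G : Type} [Group G] [Fintype G] (A : Subgroup G)
    (hA : ∀ a b : ↥A, a * b = b * a) (hcard : 3 ≤ Nat.card A) (hidx : A.index = 2)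
    (f : ↥A ≃* ↥A) (hf2 : ∀ a : ↥A, f (f a) = a) (hfne : f ≠ MulEquiv.refl ↥A)
    (x : G) (hx : x ∉ A) (y : ↥A) (hy : f y = y) (hx2 : x ^ 2 = (y : G))
    (hconj : ∀ a : ↥A, x * (a : G) * x⁻¹ = ((f a : ↥A) : G)) :
    (∀ V : FDRep ℂ G, Simple V → Module.finrank ℂ V = 1 ∨ Module.finrank ℂ V = 2) ∧
    Nat.card (Quot (fun (V W : {V : FDRep ℂ G // Simple V ∧ Module.finrank ℂ V = 2}) =>
        Nonempty ((V : FDRep ℂ G) ≅ (W : FDRep ℂ G)))) =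
      (Nat.card A - (Subgroup.closure {b : ↥A | ∃ a : ↥A, b = f a * a⁻¹}).index) / 2 ∧
    Nat.card (Quot (fun (V W : {V : FDRep ℂ G // Simple V}) =>
        Nonempty ((V : FDRep ℂ G) ≅ (W : FDRep ℂ G)))) =
      2 * (Subgroup.closure {b : ↥A | ∃ a : ↥A, b = f a * a⁻¹}).index +
        (Nat.card A - (Subgroup.closure {b : ↥A | ∃ a : ↥A, b = f a * a⁻¹}).index) / 2 := by
  exact S7.main ⟨hA, hidx, hf2, hx, hy, hx2, hconj⟩
end

section
/- Let A be a finite abelian group of exponent e not divisible by 4, and π : A → ℂ* a one-dimensional representation. If for a subset S ⊆ A one has π(S) − π(S⁻¹) ∈ iℤ (an integer multiple of the imaginary unit), then π(S) − π(S⁻¹) = 0, i.e., π(S) is real. -/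
lemma I_not_mem_aux {m : ℕ} (hm : Odd m) :
    ∃ F : Subfield ℂ, Complex.I ∉ F ∧ ∀ w : ℂ, w ^ (2 * m) = 1 → w ∈ F := by
  have : NeZero m := ⟨by rintro rfl; simp at hm⟩
  have : NeZero (m : ℚ) := ⟨by exact_mod_cast NeZero.ne m⟩
  have : IsCyclotomicExtension {m} ℚ (CyclotomicField m ℚ) :=
    CyclotomicField.isCyclotomicExtension m ℚ
  let φ : CyclotomicField m ℚ →+* ℂ := Classical.arbitrary _
  have hz := IsCyclotomicExtension.zeta_spec m ℚ (CyclotomicField m ℚ)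
  refine ⟨φ.fieldRange, ?_, ?_⟩
  · rintro ⟨x, hx⟩
    have h4 : IsPrimitiveRoot x 4 := by
      apply IsPrimitiveRoot.of_map_of_injective (f := φ) _ φ.injective
      rw [hx]
      refine IsPrimitiveRoot.mk_of_lt _ (by norm_num) Complex.I_pow_four ?_
      intro l h1 h2 h3
      interval_cases l <;> simp [Complex.ext_iff, pow_succ] at h3 <;> norm_num at h3
    have h := h4.dvd_of_isCyclotomicExtension m (by norm_num)
    obtain ⟨k, rfl⟩ := hm
    omega
  · intro w hw
    have hφ := hz.map_of_injective φ.injective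
    have key : ∀ v : ℂ, v ^ m = 1 → v ∈ φ.fieldRange := by
      intro v hv
      obtain ⟨k, -, rfl⟩ := hφ.eq_pow_of_pow_eq_one hv
      exact pow_mem (RingHom.mem_fieldRange.2 ⟨_, rfl⟩) k
    have h2 : (w ^ m - 1) * (w ^ m + 1) = 0 := by
      rw [mul_comm, pow_mul] at hw
      linear_combination hw
    rcases mul_eq_zero.1 h2 with h | h
    · exact key w (sub_eq_zero.1 h)
    · have := key (-w) (by rw [hm.neg_pow]; linear_combination -h)
      simpa using neg_mem this

/-- If the exponent of `A` is not divisible by 4 and `π(S) − π(S⁻¹) ∈ iℤ`,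
then `π(S) − π(S⁻¹) = 0`, i.e. `π(S)` is real. -/
theorem stmt_16 {A : Type*} [CommGroup A] [Fintype A]
    (he : ¬ (4 ∣ Monoid.exponent A)) (π : A →* ℂˣ) (S : Finset A)
    (h : ∃ n : ℤ, (∑ s ∈ S, (π s : ℂ)) - (∑ s ∈ S, (π s⁻¹ : ℂ)) = (n : ℂ) * Complex.I) :
    (∑ s ∈ S, (π s : ℂ)) - (∑ s ∈ S, (π s⁻¹ : ℂ)) = 0 := by
  obtain ⟨n, hn⟩ := h
  obtain ⟨m, hm, hd⟩ : ∃ m, Odd m ∧ Monoid.exponent A ∣ 2 * m := by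
    rcases Nat.even_or_odd' (Monoid.exponent A) with ⟨k, hk | hk⟩
    · refine ⟨k, ?_, by rw [hk]⟩
      rw [Nat.odd_iff]
      omega
    · exact ⟨_, ⟨k, hk⟩, Dvd.intro_left _ rfl⟩
  obtain ⟨F, hI, hF⟩ := I_not_mem_aux hm
  have hπ : ∀ a : A, (π a : ℂ) ∈ F := by
    intro a
    apply hF
    rw [← Units.val_pow_eq_pow_val, ← map_pow,
      Monoid.exponent_dvd_iff_forall_pow_eq_one.1 hd a]
    simp
  have hD : (n : ℂ) * Complex.I ∈ F := by
    rw [← hn]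
    exact sub_mem (sum_mem fun s _ => hπ s) (sum_mem fun s _ => hπ s⁻¹)
  rw [hn]
  by_cases h0 : (n : ℂ) = 0
  · rw [h0, zero_mul]
  · exfalso
    apply hI
    have := mul_mem (inv_mem (intCast_mem F n)) hD
    rwa [inv_mul_cancel_left₀ h0] at this
end
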